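/- Let χ : ℤ × ℤ → kˣ be a group homomorphism which is not the trivial homomorphism, and let k_χ denote the one-dimensional representation of ℤ × ℤ on k in which (m, n) acts by multiplication by χ(m, n). Then the group cohomology Hⁿ(ℤ × ℤ, k_χ) vanishes for every n ≥ 0. -/

import Mathlib

open CategoryTheory

open Rep in
/-- If an element `g` of a commutative group `G` acts on `A` such that `ρ(g) - 1` is invertible,
then all the cohomology of `A` vanishes: multiplication by `g` on a projective resolution of the
trivial representation is homotopic to the identity. -/
theorem groupCohomology.isZero_of_isIso_applyAsHom_sub_id.{u} {k G : Type u} [CommRing k]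
    [CommGroup G] (A : Rep k G) (g : G) [IsIso (A.applyAsHom g - 𝟙 A)] (n : ℕ) :
    Limits.IsZero (groupCohomology A n) := by
  let P := barResolution k G
  let φ : P.complex ⟶ P.complex :=
    { f i := (P.complex.X i).applyAsHom g
      comm' i j _ := applyAsHom_comm _ _ }
  have hφ : φ ≫ P.π = P.π := by
    ext : 1
    change (P.complex.X 0).applyAsHom g ≫ P.π.f 0 = P.π.f 0
    rw [applyAsHom_comm]
    have : (((ChainComplex.single₀ (Rep k G)).obj (trivial k G k)).X 0).applyAsHom g = 𝟙 _ := by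
      ext; rfl
    rw [this, Category.comp_id]
  let s : Homotopy φ (𝟙 P.complex) := ProjectiveResolution.liftHomotopy (𝟙 _) _ _
    (by simp [hφ]) (by simp)
  refine .of_iso ?_ (groupCohomologyIso A n P)
  rw [← HomologicalComplex.exactAt_iff_isZero_homology, HomologicalComplex.exactAt_iff,
    ShortComplex.moduleCat_exact_iff]
  intro f hf
  change P.complex.X n ⟶ A at f
  have hf' : P.complex.d ((ComplexShape.down ℕ).prev n) n ≫ f = 0 := hf
  have key : f ≫ (A.applyAsHom g - 𝟙 A) = dNext n s.hom ≫ f := by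
    have h : φ.f n ≫ f = (_ + _ + _) ≫ f := congrArg (· ≫ f) (s.comm n)
    change (P.complex.X n).applyAsHom g ≫ f = _ at h
    have hp : prevD n s.hom ≫ f = 0 := by
      change (_ ≫ _) ≫ f = 0
      rw [Category.assoc, hf', Limits.comp_zero]
    rw [applyAsHom_comm, Preadditive.add_comp, Preadditive.add_comp, hp] at h
    simp [Preadditive.comp_sub, h]
  refine ⟨s.hom _ n ≫ f ≫ inv (A.applyAsHom g - 𝟙 A), ?_⟩
  change P.complex.d n _ ≫ _ = f
  rw [← cancel_mono (A.applyAsHom g - 𝟙 A), key]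
  simp only [Category.assoc, IsIso.inv_hom_id, Category.comp_id]
  rfl

/-- Let `χ : ℤ × ℤ → kˣ` be a nontrivial group homomorphism
(written multiplicatively) and let `k_χ` be the one-dimensional representation
of `ℤ × ℤ` on `k` in which `(m, n)` acts by multiplication by `χ(m, n)`.
Then `Hⁿ(ℤ × ℤ, k_χ) = 0` for every `n ≥ 0`. -/
theorem stmt5 (k : Type) [Field k] [CharZero k]
    (χ : Multiplicative (ℤ × ℤ) →* kˣ) (hχ : χ ≠ 1) (n : ℕ) :
    Limits.IsZero (groupCohomology
      (Rep.of (((Units.coeHom (Module.End k k)).comp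
        ((Units.map (algebraMap k (Module.End k k)).toMonoidHom).comp χ)
          : Representation k (Multiplicative (ℤ × ℤ)) k))) n) := by
  obtain ⟨g, hg⟩ := DFunLike.ne_iff.1 hχ
  have hc : (χ g : k) - 1 ≠ 0 := sub_ne_zero.2 fun h ↦ hg (Units.ext h)
  set A := Rep.of (((Units.coeHom (Module.End k k)).comp
        ((Units.map (algebraMap k (Module.End k k)).toMonoidHom).comp χ)
          : Representation k (Multiplicative (ℤ × ℤ)) k))
  have hA : A.applyAsHom g - 𝟙 A = ((χ g : k) - 1) • 𝟙 A := by
    rw [sub_smul, one_smul]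
    congr 1
  have : IsIso (A.applyAsHom g - 𝟙 A) :=
    ⟨((χ g : k) - 1)⁻¹ • 𝟙 A, by simp [hA, smul_smul, hc], by simp [hA, smul_smul, hc]⟩
  exact groupCohomology.isZero_of_isIso_applyAsHom_sub_id A g n
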